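/- Let E be an elliptic curve over a finite field F_q with q elements. Then |q + 1 - #E(F_q)| ≤ 2·√q. -/

import Mathlib

open Polynomial

namespace WeierstrassCurve

variable {R : Type*} [CommRing R] (W : WeierstrassCurve R) (v : Fin 3 → R)

lemma eval_addSubMap_zero : (W.addSubMap 0).eval v =
    v 0 ^ 2 - W.b₄ * v 0 * v 2 - W.b₆ * v 1 * v 2 - W.b₈ * v 2 ^ 2 := by
  simp [addSubMap]

lemma eval_addSubMap_one : (W.addSubMap 1).eval v =
    2 * v 1 * v 0 + W.b₂ * v 0 * v 2 + W.b₄ * v 1 * v 2 + W.b₆ * v 2 ^ 2 := by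
  simp [addSubMap]

lemma eval_addSubMap_two : (W.addSubMap 2).eval v = v 1 ^ 2 - 4 * v 0 * v 2 := by
  simp [addSubMap]

end WeierstrassCurve

namespace WeierstrassCurve.Affine.Point

variable {K : Type*} [Field K] [DecidableEq K] {V : WeierstrassCurve K} [V.IsElliptic]

/-- On symmetric squares of `x`-coordinates, doubling is given by `addSubMap`. -/
lemma exists_addSubMap_sym2x_self (P : V.toAffine.Point) :
    ∃ c : K, c ≠ 0 ∧ ∀ i, (V.addSubMap i).eval (P.sym2x P) = c * (P + P).sym2x 0 i := by
  match P with
  | .zero =>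
    refine ⟨1, one_ne_zero, fun i ↦ ?_⟩
    rw [← zero_def]
    fin_cases i <;> simp [addSubMap]
  | .some x y h =>
    have heq := (equation_iff ..).mp h.1
    by_cases hy : y = V.toAffine.negY x y
    · rw [add_self_of_Y_eq hy]
      have h1 : (V.addSubMap 1).eval ((some x y h).sym2x (some x y h)) = 0 := by
        rw [negY] at hy
        rw [sym2x_some_some, eval_addSubMap_one]
        simp only [b₂, b₄, b₆, Matrix.cons_val]
        linear_combination (-4) * heq + (2 * y + V.a₁ * x + V.a₃) * hy
      have h2 : (V.addSubMap 2).eval ((some x y h).sym2x (some x y h)) = 0 := by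
        rw [sym2x_some_some, eval_addSubMap_two]
        simp only [Matrix.cons_val]
        ring
      refine ⟨(V.addSubMap 0).eval ((some x y h).sym2x (some x y h)), fun h0 ↦ ?_, fun i ↦ ?_⟩
      · refine V.addSubMap_ne_zero (sym2x_ne_zero (some x y h) (some x y h)) (funext fun i ↦ ?_)
        match i with
        | 0 => exact h0
        | 1 => exact h1
        | 2 => exact h2
      · rw [sym2x_zero_zero]
        match i with
        | 0 => exact (mul_one _).symm
        | 1 => exact h1.trans (mul_zero _).symm
        | 2 => exact h2.trans (mul_zero _).symm
    · have hd : y - V.toAffine.negY x y ≠ 0 := sub_ne_zero.mpr hy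
      refine ⟨(y - V.toAffine.negY x y) ^ 2, pow_ne_zero 2 hd, fun i ↦ ?_⟩
      rw [add_self_of_Y_ne hy, sym2x_some_zero, sym2x_some_some]
      fin_cases i
      · simp only [Fin.zero_eta, eval_addSubMap_zero, Matrix.cons_val]
        rw [addX, slope_of_Y_ne rfl hy]
        have h6 : V.a₆ = y ^ 2 + V.a₁ * x * y + V.a₃ * y -
            (x ^ 3 + V.a₂ * x ^ 2 + V.a₄ * x) := by
          linear_combination -heq
        generalize hD : y - V.toAffine.negY x y = D at *
        rw [negY] at hD
        field_simp
        rw [b₄, b₆, b₈, ← hD, h6]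
        ring
      · simp only [Fin.mk_one, eval_addSubMap_one, Matrix.cons_val]
        rw [negY, b₂, b₄, b₆]
        linear_combination (-4) * heq
      · simp only [Fin.reduceFinMk, eval_addSubMap_two, Matrix.cons_val]
        ring

/-- The symmetric square of the `x`-coordinates of `P + Q` and `P - Q` is given by `addSubMap`. -/
theorem exists_addSubMap_sym2x (P Q : V.toAffine.Point) :
    ∃ c : K, c ≠ 0 ∧ ∀ i, (V.addSubMap i).eval (P.sym2x Q) = c * (P + Q).sym2x (P - Q) i := by
  by_cases hPQ : P = Q
  · subst hPQ
    simpa using exists_addSubMap_sym2x_self P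
  by_cases hPQ' : P = -Q
  · subst hPQ'
    obtain ⟨c, hc, h⟩ := exists_addSubMap_sym2x_self Q
    refine ⟨c, hc, fun i ↦ ?_⟩
    rw [sym2x_neg_left, h, neg_add_cancel, ← neg_add', sym2x_neg_right, sym2x_comm]
  match P, Q with
  | .zero, Q =>
    rw [← zero_def, zero_add, zero_sub, sym2x_neg_right]
    refine ⟨1, one_ne_zero, fun i ↦ ?_⟩
    cases Q with
    | zero => exact absurd rfl hPQ
    | some x y h => fin_cases i <;> simp [addSubMap] <;> ring
  | P, .zero =>
    rw [← zero_def, add_zero, sub_zero]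
    refine ⟨1, one_ne_zero, fun i ↦ ?_⟩
    cases P with
    | zero => exact absurd rfl hPQ
    | some x y h => fin_cases i <;> simp [addSubMap] <;> ring
  | .some x₁ y₁ h₁, .some x₂ y₂ h₂ =>
    have hx : x₁ ≠ x₂ := fun hx ↦ by
      rcases X_eq_iff.mp hx with h | h
      · exact hPQ h
      · exact hPQ' h
    have e₁ := (equation_iff ..).mp h₁.1
    have e₂ := (equation_iff ..).mp h₂.1
    have hd : x₁ - x₂ ≠ 0 := sub_ne_zero.mpr hx
    refine ⟨(x₁ - x₂) ^ 2, pow_ne_zero 2 hd, fun i ↦ ?_⟩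
    rw [sub_eq_add_neg (some x₁ y₁ h₁), neg_some, add_of_X_ne hx, add_of_X_ne hx, sym2x_some_some,
      sym2x_some_some,
      slope_of_X_ne hx, slope_of_X_ne hx]
    have h4 : V.a₄ = (y₁ ^ 2 + V.a₁ * x₁ * y₁ + V.a₃ * y₁ - (x₁ ^ 3 + V.a₂ * x₁ ^ 2) -
        (y₂ ^ 2 + V.a₁ * x₂ * y₂ + V.a₃ * y₂ - (x₂ ^ 3 + V.a₂ * x₂ ^ 2))) / (x₁ - x₂) := by
      rw [eq_div_iff hd]
      linear_combination e₂ - e₁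
    have h6 : V.a₆ = y₁ ^ 2 + V.a₁ * x₁ * y₁ + V.a₃ * y₁ -
        (x₁ ^ 3 + V.a₂ * x₁ ^ 2 + V.a₄ * x₁) := by
      linear_combination -e₁
    fin_cases i
    · simp only [Fin.zero_eta, eval_addSubMap_zero, Matrix.cons_val]
      rw [addX, addX, negY, b₄, b₆, b₈, h6, h4]
      clear h4 h6 e₁ e₂
      field_simp
      ring
    · simp only [Fin.mk_one, eval_addSubMap_one, Matrix.cons_val]
      rw [addX, addX, negY, b₂, b₄, b₆, h6, h4]
      clear h4 h6 e₁ e₂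
      field_simp
      ring
    · simp only [Fin.reduceFinMk, eval_addSubMap_two, Matrix.cons_val]
      ring

end WeierstrassCurve.Affine.Point

section Triples

variable {F : Type*} [Field F]

/-- No irreducible polynomial divides all entries of `u`. -/
def Polynomial.IsPrimitiveVec {ι : Type*} (u : ι → F[X]) : Prop :=
  ∀ p : F[X], Prime p → ∃ i, ¬ p ∣ u i

/-- The largest degree of an entry of `u` is `n`. -/
def Polynomial.HasMaxDegree {ι : Type*} (u : ι → F[X]) (n : ℕ) : Prop :=
  (∀ i, (u i).natDegree ≤ n) ∧ ∃ i, (u i).coeff n ≠ 0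

/-- The symmetric product of two vectors of length two. -/
def symProd {R : Type*} [CommRing R] (u v : Fin 2 → R) : Fin 3 → R :=
  ![u 0 * v 0, u 0 * v 1 + u 1 * v 0, u 1 * v 1]

namespace Polynomial

variable {ι : Type*} {u v : ι → F[X]} {m n : ℕ}

lemma HasMaxDegree.unique (h : HasMaxDegree u m) (h' : HasMaxDegree u n) : m = n := by
  obtain ⟨h₁, i, hi⟩ := h
  obtain ⟨h₂, j, hj⟩ := h'
  exact le_antisymm ((le_natDegree_of_ne_zero hi).trans (h₂ i))
    ((le_natDegree_of_ne_zero hj).trans (h₁ j))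

lemma HasMaxDegree.congr (h : HasMaxDegree u m) (huv : ∀ i, Associated (u i) (v i)) :
    HasMaxDegree v m := by
  refine ⟨fun i ↦ ?_, ?_⟩
  · rw [← natDegree_eq_of_degree_eq (degree_eq_degree_of_associated (huv i))]
    exact h.1 i
  · obtain ⟨i, hi⟩ := h.2
    obtain ⟨w, hw⟩ := huv i
    obtain ⟨c, hc, hcw⟩ := Polynomial.isUnit_iff.mp w.isUnit
    refine ⟨i, ?_⟩
    rw [← hw, ← hcw, coeff_mul_C]
    exact mul_ne_zero hi hc.ne_zero

lemma exists_hasMaxDegree [Finite ι] (hu : u ≠ 0) : ∃ n, HasMaxDegree u n := by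
  classical
  have := Fintype.ofFinite ι
  obtain ⟨i, hi⟩ := Function.ne_iff.mp hu
  obtain ⟨j, hj, hmax⟩ := Finset.exists_max_image (Finset.univ.filter fun i ↦ u i ≠ 0)
    (fun i ↦ (u i).natDegree) ⟨i, by simpa using hi⟩
  refine ⟨(u j).natDegree, fun k ↦ ?_, j, ?_⟩
  · by_cases hk : u k = 0
    · simp [hk]
    · exact hmax k (by simpa using hk)
  · simpa using hj

lemma IsPrimitiveVec.ne_zero (h : IsPrimitiveVec u) : u ≠ 0 := by
  rintro rfl
  obtain ⟨i, hi⟩ := h X prime_X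
  exact hi (dvd_zero _)

lemma IsPrimitiveVec.isUnit_of_dvd (h : IsPrimitiveVec u) {a b : F[X]} (ha : a ≠ 0)
    (hab : IsCoprime a b) (hd : ∀ i, a ∣ b * u i) : IsUnit a := by
  by_contra hna
  obtain ⟨p, hp, hpa⟩ := WfDvdMonoid.exists_irreducible_factor hna ha
  obtain ⟨i, hi⟩ := h p hp.prime
  rcases hp.prime.dvd_or_dvd (hpa.trans (hd i)) with hb | hu
  · exact hp.not_isUnit (hab.isUnit_of_dvd' hpa hb)
  · exact hi hu

/-- Two proportional primitive vectors agree up to a unit. -/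
lemma IsPrimitiveVec.exists_unit_of_proportional {K : Type*} [Field K] {φ : F[X] →+* K}
    (hφ : Function.Injective φ) (hu : IsPrimitiveVec u) (hv : IsPrimitiveVec v)
    {c : K} (hc : c ≠ 0) (huv : ∀ i, φ (u i) = c * φ (v i)) :
    ∃ w : F[X]ˣ, ∀ i, u i = w * v i := by
  obtain ⟨j, hj⟩ := Function.ne_iff.mp hv.ne_zero
  have hj' : v j ≠ 0 := hj
  have hcross : ∀ i, v j * u i = u j * v i := fun i ↦ hφ <| by
    rw [map_mul, map_mul, huv, huv]; ring
  have huj : u j ≠ 0 := fun h ↦ by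
    have := huv j
    rw [h, map_zero, eq_comm, mul_eq_zero, map_eq_zero_iff φ hφ] at this
    tauto
  obtain ⟨a, b, g, hab, ha, hb⟩ :=
    UniqueFactorizationMonoid.exists_reduced_factors (v j) hj' (u j)
  have hg : g ≠ 0 := by rintro rfl; simp [← ha] at hj'
  have ha0 : a ≠ 0 := by rintro rfl; simp [← ha] at hj'
  have hb0 : b ≠ 0 := by rintro rfl; simp [← hb] at huj
  have key : ∀ i, a * u i = b * v i := fun i ↦ mul_left_cancel₀ hg <| by
    rw [← mul_assoc, ← mul_assoc, ha, hb, hcross]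
  obtain ⟨a, rfl⟩ := hv.isUnit_of_dvd ha0 hab.isCoprime fun i ↦ ⟨u i, (key i).symm⟩
  obtain ⟨b, rfl⟩ := hu.isUnit_of_dvd hb0 hab.isCoprime.symm fun i ↦ ⟨v i, key i⟩
  refine ⟨a⁻¹ * b, fun i ↦ ?_⟩
  rw [Units.val_mul, mul_assoc, ← key, Units.inv_mul_cancel_left]

lemma isPrimitiveVec_symProd {u v : Fin 2 → F[X]} (hu : IsPrimitiveVec u)
    (hv : IsPrimitiveVec v) : IsPrimitiveVec (symProd u v) := by
  intro p hp
  by_contra! h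
  have h0 : p ∣ u 0 * v 0 := h 0
  have h1 : p ∣ u 0 * v 1 + u 1 * v 0 := h 1
  have h2 : p ∣ u 1 * v 1 := h 2
  obtain ⟨i, hi⟩ := hu p hp
  obtain ⟨j, hj⟩ := hv p hp
  have key : ∀ a b c d : F[X], p ∣ a * c → p ∣ a * d + b * c → p ∣ b * d →
      ¬ p ∣ a → p ∣ c ∧ p ∣ d := fun a b c d hac h hbd ha ↦ by
    have hc := (hp.dvd_or_dvd hac).resolve_left ha
    exact ⟨hc, (hp.dvd_or_dvd ((dvd_add_left (hc.mul_left b)).mp h)).resolve_left ha⟩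
  have : p ∣ v 0 ∧ p ∣ v 1 := by
    fin_cases i
    · exact key _ _ _ _ h0 h1 h2 hi
    · exact (key _ _ _ _ h2 (by rwa [add_comm]) h0 hi).symm
  fin_cases j
  · exact hj this.1
  · exact hj this.2

lemma symProd_ne_zero {u v : Fin 2 → F} (hu : u ≠ 0) (hv : v ≠ 0) : symProd u v ≠ 0 := by
  intro h
  have h0 : u 0 * v 0 = 0 := congrFun h 0
  have h1 : u 0 * v 1 + u 1 * v 0 = 0 := congrFun h 1
  have h2 : u 1 * v 1 = 0 := congrFun h 2
  have : u = 0 ∨ v = 0 := by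
    rw [funext_iff, funext_iff, Fin.forall_fin_two, Fin.forall_fin_two]
    simp only [Pi.zero_apply]
    grind
  tauto

lemma HasMaxDegree.symProd {u v : Fin 2 → F[X]} (hu : HasMaxDegree u m) (hv : HasMaxDegree v n) :
    HasMaxDegree (symProd u v) (m + n) := by
  have hc : ∀ i j, (u i * v j).coeff (m + n) = (u i).coeff m * (v j).coeff n := fun i j ↦
    coeff_mul_add_eq_of_natDegree_le (hu.1 i) (hv.1 j)
  have hd : ∀ i j, (u i * v j).natDegree ≤ m + n := fun i j ↦
    natDegree_mul_le_of_le (hu.1 i) (hv.1 j)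
  refine ⟨fun i ↦ ?_, ?_⟩
  · fin_cases i
    · exact hd 0 0
    · exact natDegree_add_le_of_degree_le (hd 0 1) (hd 1 0)
    · exact hd 1 1
  · obtain ⟨i, hi⟩ := Function.ne_iff.mp <| symProd_ne_zero
      (u := fun i ↦ (u i).coeff m) (v := fun i ↦ (v i).coeff n)
      (fun h ↦ hu.2.elim fun i hi ↦ hi (congrFun h i))
      (fun h ↦ hv.2.elim fun i hi ↦ hi (congrFun h i))
    refine ⟨i, ?_⟩
    refine fun h ↦ hi (Eq.trans ?_ h)
    symm
    fin_cases i
    · exact hc 0 0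
    · exact (coeff_add _ _ _).trans (congrArg₂ _ (hc 0 1) (hc 1 0))
    · exact hc 1 1

end Polynomial

/-- The addition-and-subtraction map on vectors of polynomials. -/
noncomputable def WeierstrassCurve.addSubVec (W : WeierstrassCurve F) (u : Fin 3 → F[X]) :
    Fin 3 → F[X] :=
  fun i ↦ ((W.map (C : F →+* F[X])).addSubMap i).eval u

namespace Polynomial

variable (W : WeierstrassCurve F) [W.IsElliptic]

lemma IsPrimitiveVec.addSubVec {u : Fin 3 → F[X]} (hu : IsPrimitiveVec u) :
    IsPrimitiveVec (W.addSubVec u) := by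
  intro p hp
  by_contra! h
  obtain ⟨i, hi⟩ := hu p hp
  refine hi (hp.dvd_of_dvd_pow (n := 4) ?_)
  rw [← (W.map (C : F →+* F[X])).addSubMapCoeff_condition u i]
  exact Finset.dvd_sum fun j _ ↦ (h j).mul_left _

lemma HasMaxDegree.addSubVec {u : Fin 3 → F[X]} {n : ℕ} (hu : HasMaxDegree u n) :
    HasMaxDegree (W.addSubVec u) (n + n) := by
  have hd : ∀ i j, (u i * u j).natDegree ≤ n + n := fun i j ↦
    natDegree_mul_le_of_le (hu.1 i) (hu.1 j)
  have hc : ∀ i j, (u i * u j).coeff (n + n) = (u i).coeff n * (u j).coeff n := fun i j ↦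
    coeff_mul_add_eq_of_natDegree_le (hu.1 i) (hu.1 j)
  have hd' : ∀ a i j, (C a * (u i * u j)).natDegree ≤ n + n := fun a i j ↦
    (natDegree_C_mul_le _ _).trans (hd i j)
  have e0 : W.addSubVec u 0 = u 0 * u 0 - C W.b₄ * (u 0 * u 2) - C W.b₆ * (u 1 * u 2) -
      C W.b₈ * (u 2 * u 2) := by
    rw [WeierstrassCurve.addSubVec, WeierstrassCurve.eval_addSubMap_zero]
    simp only [WeierstrassCurve.map_b₄, WeierstrassCurve.map_b₆, WeierstrassCurve.map_b₈]
    ring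
  have e1 : W.addSubVec u 1 = C 2 * (u 1 * u 0) + C W.b₂ * (u 0 * u 2) + C W.b₄ * (u 1 * u 2) +
      C W.b₆ * (u 2 * u 2) := by
    rw [WeierstrassCurve.addSubVec, WeierstrassCurve.eval_addSubMap_one]
    simp only [WeierstrassCurve.map_b₂, WeierstrassCurve.map_b₄, WeierstrassCurve.map_b₆,
      C_ofNat]
    ring
  have e2 : W.addSubVec u 2 = u 1 * u 1 - C 4 * (u 0 * u 2) := by
    rw [WeierstrassCurve.addSubVec, WeierstrassCurve.eval_addSubMap_two, C_ofNat]
    ring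
  refine ⟨fun i ↦ ?_, ?_⟩
  · fin_cases i
    · change (W.addSubVec u 0).natDegree ≤ _
      rw [e0]
      exact natDegree_sub_le_of_le (natDegree_sub_le_of_le (natDegree_sub_le_of_le (hd _ _)
        (hd' _ _ _) |>.trans (max_self _).le) (hd' _ _ _) |>.trans (max_self _).le)
        (hd' _ _ _) |>.trans (max_self _).le
    · change (W.addSubVec u 1).natDegree ≤ _
      rw [e1]
      exact natDegree_add_le_of_degree_le (natDegree_add_le_of_degree_le
        (natDegree_add_le_of_degree_le (hd' _ _ _) (hd' _ _ _)) (hd' _ _ _)) (hd' _ _ _)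
    · change (W.addSubVec u 2).natDegree ≤ _
      rw [e2]
      exact natDegree_sub_le_of_le (hd _ _) (hd' _ _ _) |>.trans (max_self _).le
  · obtain ⟨i, hi⟩ := Function.ne_iff.mp <| W.addSubMap_ne_zero (x := fun i ↦ (u i).coeff n)
      (fun h ↦ hu.2.elim fun i hi ↦ hi (congrFun h i))
    refine ⟨i, ?_⟩
    refine fun h ↦ hi (Eq.trans ?_ h)
    symm
    fin_cases i
    · change (W.addSubVec u 0).coeff _ = (W.addSubMap 0).eval _
      rw [e0, WeierstrassCurve.eval_addSubMap_zero]
      simp only [coeff_sub, coeff_C_mul, hc]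
      ring
    · change (W.addSubVec u 1).coeff _ = (W.addSubMap 1).eval _
      rw [e1, WeierstrassCurve.eval_addSubMap_one]
      simp only [coeff_add, coeff_C_mul, hc]
      ring
    · change (W.addSubVec u 2).coeff _ = (W.addSubMap 2).eval _
      rw [e2, WeierstrassCurve.eval_addSubMap_two]
      simp only [coeff_sub, coeff_C_mul, hc]
      ring

end Polynomial

end Triples

namespace WeierstrassCurve.Affine.Point

section Height

variable {F K : Type*} [Field F] [Field K] {φ : F[X] →+* K}

/-- The polynomials `u` are homogeneous coordinates of the `x`-coordinate of `P`. -/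
def IsXCoord (φ : F[X] →+* K) {V : WeierstrassCurve K} (P : V.toAffine.Point)
    (u : Fin 2 → F[X]) : Prop :=
  ∃ c : K, c ≠ 0 ∧ ∀ i, φ (u i) = c * P.xRep i

/-- The `x`-coordinate of `P` is a rational function of degree `n`. -/
def HasHeight (φ : F[X] →+* K) {V : WeierstrassCurve K} (P : V.toAffine.Point) (n : ℕ) : Prop :=
  ∃ u, IsXCoord φ P u ∧ IsPrimitiveVec u ∧ HasMaxDegree u n

variable {V : WeierstrassCurve K} {P Q : V.toAffine.Point} {u v r s : Fin 2 → F[X]} {m n : ℕ}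

lemma isXCoord_some {x y : K} (h : V.toAffine.Nonsingular x y) (hu : φ (u 1) ≠ 0)
    (hx : φ (u 0) = φ (u 1) * x) : IsXCoord φ (some x y h) u :=
  ⟨φ (u 1), hu, Fin.forall_fin_two.mpr ⟨by simpa using hx, by simp⟩⟩

lemma IsXCoord.exists_isPrimitiveVec (h : IsXCoord φ P u) :
    ∃ v, IsXCoord φ P v ∧ IsPrimitiveVec v := by
  obtain ⟨c, hc, hu⟩ := h
  have hu0 : ¬ (u 0 = 0 ∧ u 1 = 0) := fun ⟨h0, h1⟩ ↦ P.xRep_ne_zero <| by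
    have e0 := hu 0
    have e1 := hu 1
    rw [h0, _root_.map_zero, eq_comm, mul_eq_zero] at e0
    rw [h1, _root_.map_zero, eq_comm, mul_eq_zero] at e1
    exact funext (Fin.forall_fin_two.mpr ⟨e0.resolve_left hc, e1.resolve_left hc⟩)
  obtain ⟨a, b, g, hab, ha, hb⟩ : ∃ a b g, IsRelPrime a b ∧ g * a = u 0 ∧ g * b = u 1 := by
    by_cases h0 : u 0 = 0
    · exact UniqueFactorizationMonoid.exists_reduced_factors' _ _ fun h1 ↦ hu0 ⟨h0, h1⟩
    · exact UniqueFactorizationMonoid.exists_reduced_factors _ h0 _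
  have hg : φ g ≠ 0 := by
    intro hg
    refine P.xRep_ne_zero (funext fun i ↦ (mul_eq_zero.mp ((hu i).symm.trans ?_)).resolve_left hc)
    fin_cases i
    · simp [← ha, hg]
    · simp [← hb, hg]
  refine ⟨![a, b], ⟨c / φ g, div_ne_zero hc hg, Fin.forall_fin_two.mpr ⟨?_, ?_⟩⟩, ?_⟩
  · rw [div_mul_eq_mul_div, eq_div_iff hg, ← hu, ← ha, map_mul, mul_comm]; rfl
  · rw [div_mul_eq_mul_div, eq_div_iff hg, ← hu, ← hb, map_mul, mul_comm]; rfl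
  · intro p hp
    by_contra! h
    exact hp.not_isUnit (hab (h 0) (h 1))

lemma IsXCoord.exists_hasHeight (h : IsXCoord φ P u) : ∃ n, HasHeight φ P n := by
  obtain ⟨v, hv, hp⟩ := h.exists_isPrimitiveVec
  obtain ⟨n, hn⟩ := exists_hasMaxDegree hp.ne_zero
  exact ⟨n, v, hv, hp, hn⟩

lemma HasHeight.unique (hφ : Function.Injective φ) (h : HasHeight φ P m) (h' : HasHeight φ P n) :
    m = n := by
  obtain ⟨u, ⟨c, hc, hu⟩, hup, hud⟩ := h
  obtain ⟨v, ⟨d, hd, hv⟩, hvp, hvd⟩ := h'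
  obtain ⟨w, hw⟩ := hup.exists_unit_of_proportional hφ hvp (div_ne_zero hc hd) fun i ↦ by
    rw [hu, hv]; field_simp
  refine (hud.congr fun i ↦ ?_).unique hvd
  rw [hw]
  exact associated_unit_mul_left _ _ w.isUnit

end Height

section Parallelogram

variable {F K : Type*} [Field F] [Field K] [DecidableEq K] {φ : F[X] →+* K}
  {W : WeierstrassCurve F} [W.IsElliptic] {P Q : (W.map (φ.comp C)).toAffine.Point}
  {u v r s : Fin 2 → F[X]}

lemma IsXCoord.exists_addSubVec (hu : IsXCoord φ P u) (hv : IsXCoord φ Q v) :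
    ∃ c : K, c ≠ 0 ∧ ∀ i, φ (W.addSubVec (symProd u v) i) = c * (P + Q).sym2x (P - Q) i := by
  obtain ⟨c, hc, hu⟩ := hu
  obtain ⟨d, hd, hv⟩ := hv
  obtain ⟨e, he, h⟩ := exists_addSubMap_sym2x P Q
  have hsym : ∀ i, φ (symProd u v i) = c * d * P.sym2x Q i := fun i ↦ by
    fin_cases i
    · simp [symProd, sym2x, hu, hv]; ring
    · simp [symProd, sym2x, hu, hv]; ring
    · simp [symProd, sym2x, hu, hv]; ring
  refine ⟨(c * d) ^ 2 * e, mul_ne_zero (pow_ne_zero 2 (mul_ne_zero hc hd)) he, fun i ↦ ?_⟩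
  rw [mul_assoc, ← h i, addSubVec]
  match i with
  | 0 =>
    simp only [eval_addSubMap_zero, map_b₄, map_b₆, map_b₈, map_sub, map_mul, map_pow, hsym,
      RingHom.comp_apply]
    ring
  | 1 =>
    simp only [eval_addSubMap_one, map_b₂, map_b₄, map_b₆, map_add, map_mul, map_pow, hsym,
      RingHom.comp_apply, map_ofNat]
    ring
  | 2 =>
    simp only [eval_addSubMap_two, map_sub, map_mul, map_pow, hsym, map_ofNat]
    ring

lemma IsXCoord.exists_unit_addSubVec (hφ : Function.Injective φ)
    (hu : IsXCoord φ P u) (hv : IsXCoord φ Q v) (hr : IsXCoord φ (P + Q) r)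
    (hs : IsXCoord φ (P - Q) s) (hup : IsPrimitiveVec u) (hvp : IsPrimitiveVec v)
    (hrp : IsPrimitiveVec r) (hsp : IsPrimitiveVec s) :
    ∃ w : F[X]ˣ, ∀ i, W.addSubVec (symProd u v) i = w * symProd r s i := by
  obtain ⟨e, he, h⟩ := hu.exists_addSubVec hv
  obtain ⟨c, hc, hr⟩ := hr
  obtain ⟨d, hd, hs⟩ := hs
  refine ((isPrimitiveVec_symProd hup hvp).addSubVec W).exists_unit_of_proportional hφ
    (isPrimitiveVec_symProd hrp hsp) (c := e / (c * d)) (div_ne_zero he (mul_ne_zero hc hd)) ?_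
  intro i
  rw [h, div_mul_eq_mul_div, eq_div_iff (mul_ne_zero hc hd), mul_assoc]
  congr 1
  fin_cases i
  · simp [symProd, sym2x, hr, hs]; ring
  · simp [symProd, sym2x, hr, hs]; ring
  · simp [symProd, sym2x, hr, hs]; ring

/-- The parallelogram law. -/
theorem HasHeight.parallelogram (hφ : Function.Injective φ) {k l m n : ℕ} (hP : HasHeight φ P k)
    (hQ : HasHeight φ Q l) (hadd : HasHeight φ (P + Q) m) (hsub : HasHeight φ (P - Q) n) :
    m + n = 2 * k + 2 * l := by
  obtain ⟨u, hu, hup, hud⟩ := hP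
  obtain ⟨v, hv, hvp, hvd⟩ := hQ
  obtain ⟨r, hr, hrp, hrd⟩ := hadd
  obtain ⟨s, hs, hsp, hsd⟩ := hsub
  obtain ⟨w, hw⟩ := hu.exists_unit_addSubVec hφ hv hr hs hup hvp hrp hsp
  have := ((hrd.symProd hsd).congr fun i ↦ by
    rw [hw]
    exact (associated_unit_mul_left _ _ w.isUnit).symm).unique ((hud.symProd hvd).addSubVec W)
  omega

/-- If the `x`-coordinates of `P`, `Q` and `P - Q` are rational functions, so is that of
`P + Q`. -/
lemma IsXCoord.exists_add (hu : IsXCoord φ P u) (hv : IsXCoord φ Q v)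
    (hs : IsXCoord φ (P - Q) s) : ∃ r, IsXCoord φ (P + Q) r := by
  obtain ⟨e, he, h⟩ := hu.exists_addSubVec hv
  obtain ⟨d, hd, hs⟩ := hs
  have h0 := h 0
  have h1 := h 1
  have h2 := h 2
  simp only [sym2x, Matrix.cons_val] at h0 h1 h2
  generalize W.addSubVec (symProd u v) = t at *
  generalize P - Q = T at *
  match T with
  | .zero =>
    rw [← zero_def, xRep_zero] at h0 h1
    exact ⟨![t 0, t 1], e, he, Fin.forall_fin_two.mpr ⟨by simpa using h0, by simpa using h1⟩⟩
  | .some x y hxy =>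
    rw [xRep_some] at h1 h2 hs
    have hs0 := hs 0
    have hs1 := hs 1
    simp only [Matrix.cons_val] at hs0 hs1 h1 h2
    refine ⟨![t 1 * s 1 - s 0 * t 2, s 1 * t 2], e * d, mul_ne_zero he hd,
      Fin.forall_fin_two.mpr ⟨?_, ?_⟩⟩
    · simp only [Matrix.cons_val, map_sub, map_mul, hs0, hs1, h1, h2]
      ring
    · simp only [Matrix.cons_val, map_mul, hs1, h2]
      ring

end Parallelogram

end WeierstrassCurve.Affine.Point

/-- A sequence with constant second difference `2` is a monic quadratic polynomial. -/
lemma Int.eq_quadratic_of_second_difference {d : ℤ → ℤ}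
    (h : ∀ n, d (n + 1) + d (n - 1) = 2 * d n + 2) (n : ℤ) :
    d n = n ^ 2 + (d 1 - d 0 - 1) * n + d 0 := by
  have key : ∀ n : ℤ, d n = n ^ 2 + (d 1 - d 0 - 1) * n + d 0 ∧
      d (n + 1) = (n + 1) ^ 2 + (d 1 - d 0 - 1) * (n + 1) + d 0 := by
    intro n
    induction n using Int.induction_on with
    | zero => exact ⟨by ring, by rw [zero_add]; ring⟩
    | succ k ih =>
      refine ⟨ih.2, ?_⟩
      have := h (k + 1)
      rw [add_sub_cancel_right] at this
      linear_combination this + 2 * ih.2 - ih.1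
    | pred k ih =>
      rw [sub_add_cancel]
      have := h (-k)
      exact ⟨by linear_combination this + 2 * ih.1 - ih.2, ih.1⟩
  exact (key n).1

/-- A monic integral quadratic polynomial which is nonnegative on the integers, whose constant
term is a prime power and whose linear coefficient is not too large has nonpositive
discriminant. -/
lemma Int.sq_le_of_forall_quadratic_nonneg {q : ℕ} (hq : IsPrimePow q) {a : ℤ} (ha : |a| ≤ q)
    (h : ∀ n : ℤ, 0 ≤ n ^ 2 + a * n + q) : a ^ 2 ≤ 4 * q := by
  rcases Int.even_or_odd' a with ⟨b, rfl | rfl⟩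
  · nlinarith [h (-b)]
  · by_contra! hlt
    have h1 := h (-b)
    have hqb : (q : ℤ) = b * (b + 1) := by nlinarith
    wlog hb : 0 ≤ b generalizing b
    · refine this (b := -b - 1) (by rwa [← abs_neg, show -(2 * (-b - 1) + 1) = 2 * b + 1 by ring])
        (fun n ↦ ?_) ?_ ?_ ?_ (by omega)
      · convert h (-n) using 1; ring
      · convert hlt using 1; ring
      · convert h (-b - 1) using 1; ring
      · rw [hqb]; ring
    lift b to ℕ using hb
    have hqb' : q = b * (b + 1) := by exact_mod_cast hqb
    have hb0 : 0 < b := by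
      rcases Nat.eq_zero_or_pos b with rfl | hb
      · simp at hqb'; exact absurd hqb' hq.ne_zero
      · exact hb
    have hdvd : q ∣ b ∨ q ∣ b + 1 := by
      have := (Nat.Coprime.isPrimePow_dvd_mul (Nat.coprime_self_add_right.mpr
        (Nat.coprime_one_right b)) hq).mp hqb'.dvd
      exact this
    have hb1 : b = 1 := by
      rcases hdvd with hd | hd
      · have := Nat.le_of_dvd hb0 hd
        nlinarith
      · have := Nat.le_of_dvd b.succ_pos hd
        nlinarith
    subst hb1
    rw [hqb] at ha
    norm_num at ha

namespace Polynomial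

variable {F : Type*} [Field F]

lemma natDegree_le_of_mul_add_mul {a b c d : F[X]} {N : ℕ} (hb : b ≠ 0)
    (hN : b.natDegree + d.natDegree = N) (h : (a * d + b * c).natDegree ≤ N + 1)
    (hab : a.natDegree ≤ b.natDegree) : c.natDegree ≤ d.natDegree + 1 := by
  by_contra! hlt
  have hc : c ≠ 0 := by rintro rfl; simp at hlt
  have h1 : (b * c).natDegree = b.natDegree + c.natDegree := natDegree_mul hb hc
  have h2 : (a * d).natDegree ≤ a.natDegree + d.natDegree := natDegree_mul_le
  rw [natDegree_add_eq_right_of_natDegree_lt (by omega)] at h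
  omega

lemma HasMaxDegree.eq_max {u : Fin 2 → F[X]} {n : ℕ} (h : HasMaxDegree u n) :
    n = max (u 0).natDegree (u 1).natDegree := by
  obtain ⟨hle, i, hi⟩ := h
  have h0 := hle 0
  have h1 := hle 1
  have h2 := le_natDegree_of_ne_zero hi
  fin_cases i
  · exact le_antisymm (le_max_of_le_left h2) (max_le h0 h1)
  · exact le_antisymm (le_max_of_le_right h2) (max_le h0 h1)

/-- If two rational functions `r` and `s` with a total degree exceeding that of their denominators
by two have a sum with a pole of order at most one at infinity, then `s` has a pole of order
one at infinity. -/
lemma HasMaxDegree.eq_natDegree_add_one {r s : Fin 2 → F[X]} {m n N : ℕ} (hr : HasMaxDegree r m)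
    (hs : HasMaxDegree s n) (hr1 : r 1 ≠ 0) (hs1 : s 1 ≠ 0)
    (hN : (r 1).natDegree + (s 1).natDegree = N) (hmn : m + n = N + 2)
    (h : (r 0 * s 1 + r 1 * s 0).natDegree ≤ N + 1) : n = (s 1).natDegree + 1 := by
  have hm := hr.eq_max
  have hn := hs.eq_max
  have h1 := natDegree_le_of_mul_add_mul hr1 hN h
  have h2 := natDegree_le_of_mul_add_mul (a := s 0) (d := r 1) (c := r 0) hs1
    ((add_comm _ _).trans hN) (by convert h using 2; ring)
  omega

lemma IsPrimitiveVec.rootMultiplicity_of_cross {r : Fin 2 → F[X]} (hr : IsPrimitiveVec r)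
    {g m : F[X]} {x : F} (hg : g ≠ 0) (hgx : g.rootMultiplicity x = 1) (hr1 : r 1 ≠ 0)
    (h : r 0 * g ^ 2 = m * r 1) :
    (m.eval x ≠ 0 → 2 ≤ (r 1).rootMultiplicity x) ∧
      (m.eval x = 0 → (r 1).rootMultiplicity x ≤ 1) := by
  have hg2 : (g ^ 2).rootMultiplicity x = 2 := by
    rw [sq, rootMultiplicity_mul (mul_ne_zero hg hg), hgx]
  constructor
  · intro hm
    have hm0 : m ≠ 0 := by rintro rfl; simp at hm
    have hne : m * r 1 ≠ 0 := mul_ne_zero hm0 hr1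
    have := congrArg (rootMultiplicity x) h
    rw [rootMultiplicity_mul hne, rootMultiplicity_mul (h ▸ hne), hg2,
      rootMultiplicity_eq_zero (p := m) hm] at this
    omega
  · intro hm
    by_contra! hlt
    have hx1 : X - C x ∣ r 1 := dvd_iff_isRoot.mpr ((rootMultiplicity_pos hr1).mp (by omega))
    obtain ⟨i, hi⟩ := hr _ (prime_X_sub_C x)
    have hx0 : ¬ X - C x ∣ r 0 := by
      fin_cases i
      · exact hi
      · exact absurd hx1 hi
    have hr0 : r 0 ≠ 0 := fun h0 ↦ hx0 (h0 ▸ dvd_zero _)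
    have hne : r 0 * g ^ 2 ≠ 0 := mul_ne_zero hr0 (pow_ne_zero 2 hg)
    have hm0 : m ≠ 0 := fun hm0 ↦ hne (by rw [h, hm0, zero_mul])
    have := congrArg (rootMultiplicity x) h
    rw [rootMultiplicity_mul hne, rootMultiplicity_mul (h ▸ hne), hg2,
      rootMultiplicity_eq_zero (p := r 0) (fun hr ↦ hx0 (dvd_iff_isRoot.mpr hr))] at this
    have := (rootMultiplicity_pos hm0).mpr hm
    omega

lemma sum_rootMultiplicity_le [Fintype F] (p : F[X]) :
    ∑ x, p.rootMultiplicity x ≤ p.natDegree := by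
  classical
  simp_rw [← count_roots]
  rw [Multiset.sum_count_eq_card fun a _ ↦ Finset.mem_univ a]
  exact card_roots' p

end Polynomial

namespace FiniteField

variable (F : Type*) [Field F] [Fintype F]

lemma rootMultiplicity_X_pow_card_sub_X (x : F) :
    (X ^ Fintype.card F - X : F[X]).rootMultiplicity x = 1 := by
  classical
  rw [← count_roots, roots_X_pow_card_sub_X]
  exact Multiset.count_eq_one_of_mem Finset.univ.nodup (Finset.mem_univ x)

variable {F} in
lemma mem_range_algebraMap_of_pow_card_eq_self {L : Type*} [Field L] [Algebra F L] {y : L}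
    (hy : y ^ Fintype.card F = y) : ∃ z : F, algebraMap F L z = y := by
  have hq := Fintype.one_lt_card (α := F)
  have hs : (X ^ Fintype.card F - X : F[X]).Splits := splits_iff_card_roots.mpr <| by
    rw [roots_X_pow_card_sub_X, X_pow_card_sub_X_natDegree_eq F hq]
    rfl
  obtain ⟨z, hz⟩ := hs.mem_range_of_isRoot (X_pow_card_sub_X_ne_zero F hq)
    (i := algebraMap F L) (x := y) (by simp [hy])
  exact ⟨z, hz⟩

/-- Complementary divisors of `(X ^ q - X) ^ 2` split. -/
lemma natDegree_eq_sum_rootMultiplicity {r s : F[X]} {w : F[X]ˣ}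
    (h : (X ^ Fintype.card F - X : F[X]) ^ 2 = (w : F[X]) * (r * s)) :
    r.natDegree + s.natDegree = 2 * Fintype.card F ∧
      (∀ x, r.rootMultiplicity x + s.rootMultiplicity x = 2) ∧
      s.natDegree = ∑ x, s.rootMultiplicity x := by
  have hq := Fintype.one_lt_card (α := F)
  have hg : (X ^ Fintype.card F - X : F[X]) ≠ 0 := X_pow_card_sub_X_ne_zero F hq
  have hne : (w : F[X]) * (r * s) ≠ 0 := h ▸ pow_ne_zero 2 hg
  have hrs : r * s ≠ 0 := right_ne_zero_of_mul hne
  have hw : ∀ x, (w : F[X]).rootMultiplicity x = 0 := fun x ↦ rootMultiplicity_eq_zero fun hx ↦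
    not_isUnit_X_sub_C x (isUnit_of_dvd_unit (dvd_iff_isRoot.mpr hx) w.isUnit)
  have hdeg : r.natDegree + s.natDegree = 2 * Fintype.card F := by
    have := congrArg natDegree h
    rw [natDegree_pow, X_pow_card_sub_X_natDegree_eq F hq, natDegree_mul w.ne_zero hrs,
      natDegree_mul (left_ne_zero_of_mul hrs) (right_ne_zero_of_mul hrs),
      natDegree_eq_zero_of_isUnit w.isUnit] at this
    omega
  have hmul : ∀ x, r.rootMultiplicity x + s.rootMultiplicity x = 2 := fun x ↦ by
    have := congrArg (rootMultiplicity x) h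
    rw [rootMultiplicity_mul hne, rootMultiplicity_mul hrs, hw, sq,
      rootMultiplicity_mul (mul_ne_zero hg hg), rootMultiplicity_X_pow_card_sub_X] at this
    omega
  refine ⟨hdeg, hmul, ?_⟩
  have h1 := sum_rootMultiplicity_le r
  have h2 := sum_rootMultiplicity_le s
  have h3 : ∑ x, r.rootMultiplicity x + ∑ x, s.rootMultiplicity x = 2 * Fintype.card F := by
    rw [← Finset.sum_add_distrib, Finset.sum_congr rfl fun x _ ↦ hmul x]
    simp [mul_comm]
  omega

end FiniteField

namespace WeierstrassCurve.Affine.CoordinateRing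

variable {F : Type*} [Field F] (W : WeierstrassCurve F)

lemma mk_X_sq : mk W.toAffine X ^ 2 +
    algebraMap F[X] _ (C W.a₁ * X + C W.a₃) * mk W.toAffine X =
      algebraMap F[X] _ (X ^ 3 + C W.a₂ * X ^ 2 + C W.a₄ * X + C W.a₆) := by
  have h : mk W.toAffine (X ^ 2 + C (C W.a₁ * X + C W.a₃) * X -
      C (X ^ 3 + C W.a₂ * X ^ 2 + C W.a₄ * X + C W.a₆)) = 0 := AdjoinRoot.mk_self
  rw [map_sub, map_add, map_mul, map_pow] at h
  exact sub_eq_zero.mp h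

/-- The involution of the coordinate ring induced by negation. -/
noncomputable def negHom : W.toAffine.CoordinateRing →ₐ[F[X]] W.toAffine.CoordinateRing :=
  AdjoinRoot.liftAlgHom _ (Algebra.ofId _ _)
    (-mk W.toAffine X - algebraMap F[X] _ (C W.a₁ * X + C W.a₃)) <| by
      have h := mk_X_sq W
      simp only [polynomial, eval₂_add, eval₂_sub, eval₂_mul, eval₂_pow, eval₂_X, eval₂_C,
        RingHom.coe_coe, Algebra.ofId_apply]
      linear_combination h

lemma negHom_mk_X : negHom W (mk W.toAffine X) =
    -mk W.toAffine X - algebraMap F[X] _ (C W.a₁ * X + C W.a₃) :=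
  AdjoinRoot.liftAlgHom_root ..

variable {W} in
lemma exists_algebraMap_eq_of_negHom_eq [W.IsElliptic] {z : W.toAffine.CoordinateRing}
    (hz : negHom W z = z) : ∃ p : F[X], algebraMap F[X] _ p = z := by
  obtain ⟨p, q, rfl⟩ := exists_smul_basis_eq z
  have h : (q * (C W.a₁ * X + C W.a₃)) • (1 : W.toAffine.CoordinateRing) +
      (2 * q) • mk W.toAffine X = 0 := by
    rw [map_add, map_smul, map_smul, map_one, negHom_mk_X] at hz
    simp only [Algebra.smul_def, map_mul, map_ofNat] at hz ⊢
    linear_combination -hz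
  obtain ⟨h1, h2⟩ := smul_basis_eq_zero h
  have hq : q = 0 := by
    by_contra hq
    have h2' : (2 : F[X]) = 0 := (mul_eq_zero.mp h2).resolve_right hq
    have h1' := (mul_eq_zero.mp h1).resolve_left hq
    have e1 : W.a₁ = 0 := by simpa using congrArg (coeff · 1) h1'
    have e3 : W.a₃ = 0 := by simpa using congrArg (coeff · 0) h1'
    have e2 : (2 : F) = 0 := by
      rw [← C_inj, C_ofNat, h2', C_0]
    refine W.isUnit_Δ.ne_zero ?_
    rw [Δ, b₂, b₄, b₆, b₈, e1, e3]
    linear_combination (-24 * W.a₂ ^ 2 * W.a₄ ^ 2 + 96 * W.a₂ ^ 3 * W.a₆ -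
      32 * W.a₂ ^ 2 * (4 * W.a₂ * W.a₆ - W.a₄ ^ 2) - 32 * W.a₄ ^ 3 - 216 * W.a₆ ^ 2 +
      144 * W.a₂ * W.a₄ * W.a₆) * e2
  exact ⟨p, by rw [hq, zero_smul, add_zero, Algebra.algebraMap_eq_smul_one]⟩

/-- Evaluation of functions at a point with coordinates in an extension field. -/
lemma exists_specialization {L : Type*} [Field L] [Algebra F L] (x : F) (y : L)
    (h : y ^ 2 + algebraMap F L (W.a₁ * x + W.a₃) * y =
      algebraMap F L (x ^ 3 + W.a₂ * x ^ 2 + W.a₄ * x + W.a₆)) :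
    ∃ ψ : W.toAffine.CoordinateRing →+* L, ψ (mk W.toAffine X) = y ∧
      ∀ p : F[X], ψ (algebraMap F[X] _ p) = algebraMap F L (p.eval x) := by
  refine ⟨AdjoinRoot.lift ((algebraMap F L).comp (evalRingHom x)) y ?_, AdjoinRoot.lift_root _,
    fun p ↦ AdjoinRoot.lift_of _⟩
  simp only [polynomial, eval₂_add, eval₂_sub, eval₂_mul, eval₂_pow, eval₂_X, eval₂_C,
    RingHom.comp_apply, coe_evalRingHom, eval_add, eval_mul, eval_pow, eval_X, eval_C]
  linear_combination h

variable [Fintype F]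

/-- For `η` one of the two `Y`-coordinates on the curve, this is the numerator of the
`X`-coordinate of the sum of the Frobenius point and `(X, η)`. -/
noncomputable def frobNum (η : W.toAffine.CoordinateRing) : W.toAffine.CoordinateRing :=
  (mk W.toAffine X ^ Fintype.card F - η) ^ 2 +
    algebraMap F[X] _ (C W.a₁ * (X ^ Fintype.card F - X)) * (mk W.toAffine X ^ Fintype.card F - η) -
    algebraMap F[X] _ ((C W.a₂ + X + X ^ Fintype.card F) * (X ^ Fintype.card F - X) ^ 2)

lemma negHom_mk_X_pow_card : negHom W (mk W.toAffine X ^ Fintype.card F) =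
    -mk W.toAffine X ^ Fintype.card F -
      algebraMap F[X] _ (C W.a₁ * X ^ Fintype.card F + C W.a₃) := by
  have hp : (C W.a₁ * X + C W.a₃) ^ Fintype.card F =
      C W.a₁ * X ^ Fintype.card F + C W.a₃ := by
    rw [← FiniteField.expand_card, map_add, map_mul, expand_C, expand_C, expand_X]
  have h := congrArg (FiniteField.frobeniusAlgHom F W.toAffine.CoordinateRing) (negHom_mk_X W)
  rw [map_sub, map_neg] at h
  simp only [FiniteField.coe_frobeniusAlgHom, ← map_pow, hp] at h
  rw [← map_pow, h]

variable {W} in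
lemma exists_algebraMap_eq_frobNum [W.IsElliptic] {η : W.toAffine.CoordinateRing}
    (hη : negHom W η = -η - algebraMap F[X] _ (C W.a₁ * X + C W.a₃)) :
    ∃ p : F[X], algebraMap F[X] _ p = frobNum W η := by
  refine exists_algebraMap_eq_of_negHom_eq ?_
  simp only [frobNum, map_sub, map_add, map_mul, map_pow _ _ 2, AlgHom.commutes,
    negHom_mk_X_pow_card, hη]
  ring

end WeierstrassCurve.Affine.CoordinateRing

namespace WeierstrassCurve.Affine

variable {F : Type*} [Field F] (W : WeierstrassCurve F)

/-- The coordinate ring as a subring of the function field. -/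
noncomputable def polyHom : F[X] →+* W.toAffine.FunctionField :=
  (algebraMap W.toAffine.CoordinateRing _).comp (algebraMap F[X] _)

lemma polyHom_apply (p : F[X]) : polyHom W p =
    algebraMap W.toAffine.CoordinateRing _ (algebraMap F[X] _ p) := rfl

lemma polyHom_injective : Function.Injective (polyHom W) :=
  (IsFractionRing.injective W.toAffine.CoordinateRing W.toAffine.FunctionField).comp
    (FaithfulSMul.algebraMap_injective _ _)

lemma equation_map_polyHom {p : F[X]} {η : W.toAffine.CoordinateRing}
    (h : η ^ 2 + algebraMap F[X] _ (C W.a₁ * p + C W.a₃) * η =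
      algebraMap F[X] _ (p ^ 3 + C W.a₂ * p ^ 2 + C W.a₄ * p + C W.a₆)) :
    (W.map ((polyHom W).comp C)).toAffine.Equation (polyHom W p) (algebraMap _ _ η) := by
  have := congrArg (algebraMap W.toAffine.CoordinateRing W.toAffine.FunctionField) h
  rw [equation_iff]
  simp only [map_add, map_mul, map_pow, ← polyHom_apply] at this
  simp only [map_a₁, map_a₂, map_a₃, map_a₄, map_a₆, RingHom.comp_apply]
  linear_combination this

namespace CoordinateRing

lemma mk_X_pow_card_sq [Fintype F] : (mk W.toAffine X ^ Fintype.card F) ^ 2 +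
    algebraMap F[X] _ (C W.a₁ * X ^ Fintype.card F + C W.a₃) * mk W.toAffine X ^ Fintype.card F =
      algebraMap F[X] _ ((X ^ Fintype.card F) ^ 3 + C W.a₂ * (X ^ Fintype.card F) ^ 2 +
        C W.a₄ * X ^ Fintype.card F + C W.a₆) := by
  have hp (p : F[X]) : algebraMap F[X] W.toAffine.CoordinateRing p ^ Fintype.card F =
      algebraMap F[X] _ (expand F (Fintype.card F) p) := by
    rw [FiniteField.expand_card, map_pow]
  have h := congrArg (FiniteField.frobeniusAlgHom F W.toAffine.CoordinateRing) (mk_X_sq W)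
  rw [map_add, map_mul, map_pow _ _ 2] at h
  simp only [FiniteField.coe_frobeniusAlgHom, hp] at h
  simpa only [map_add, map_mul, map_pow, expand_C, expand_X] using h

end CoordinateRing

section Elliptic

variable [W.IsElliptic]

/-- The generic point, corresponding to the identity of the curve. -/
noncomputable def genericPoint : (W.map ((polyHom W).comp C)).toAffine.Point :=
  .some _ _ <| equation_iff_nonsingular.mp <| equation_map_polyHom W <| CoordinateRing.mk_X_sq W

lemma isXCoord_genericPoint : Point.IsXCoord (polyHom W) (genericPoint W) ![X, 1] :=
  Point.isXCoord_some _ (by simp) (by simp)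

variable [Fintype F]

/-- The image of the generic point under the Frobenius endomorphism. -/
noncomputable def frobPoint : (W.map ((polyHom W).comp C)).toAffine.Point :=
  .some _ _ <| equation_iff_nonsingular.mp <| equation_map_polyHom W <|
    CoordinateRing.mk_X_pow_card_sq W

lemma isXCoord_frobPoint :
    Point.IsXCoord (polyHom W) (frobPoint W) ![X ^ Fintype.card F, 1] :=
  Point.isXCoord_some _ (by simp) (by simp)

variable {W} in
lemma isXCoord_frobPoint_add [DecidableEq W.toAffine.FunctionField]
    {y : W.toAffine.FunctionField} {η : W.toAffine.CoordinateRing}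
    {p : F[X]} (hp : algebraMap F[X] _ p = CoordinateRing.frobNum W η)
    (h : (W.map ((polyHom W).comp C)).toAffine.Nonsingular (polyHom W X) y)
    (hy : y = algebraMap _ _ η) :
    Point.IsXCoord (polyHom W) (frobPoint W + .some _ _ h)
      ![p, (X ^ Fintype.card F - X) ^ 2] := by
  have hg : polyHom W (X ^ Fintype.card F - X) ≠ 0 :=
    (map_ne_zero_iff _ (polyHom_injective W)).mpr
      (FiniteField.X_pow_card_sub_X_ne_zero F Fintype.one_lt_card)
  have hx : polyHom W (X ^ Fintype.card F) ≠ polyHom W X := fun hx ↦ hg <| by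
    rw [map_sub, hx, sub_self]
  rw [frobPoint, Point.add_of_X_ne hx]
  refine Point.isXCoord_some _ (by simpa using hg) ?_
  rw [map_sub] at hg
  have hp' := congrArg (algebraMap W.toAffine.CoordinateRing W.toAffine.FunctionField) hp
  simp only [CoordinateRing.frobNum, map_add, map_sub, map_mul, ← polyHom_apply, map_pow _ _ 2]
    at hp'
  simp only [Matrix.cons_val, addX, slope_of_X_ne hx, hy, hp', map_a₁, map_a₂, RingHom.comp_apply,
    map_sub, map_pow _ _ 2]
  field_simp
  ring

end Elliptic

end WeierstrassCurve.Affine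

namespace WeierstrassCurve.Affine

section Cross

variable {F K : Type*} [Field F] [Field K] {φ : F[X] →+* K} {V : WeierstrassCurve K}
  {P : V.toAffine.Point} {u v : Fin 2 → F[X]}

lemma Point.IsXCoord.cross_mul_eq (hφ : Function.Injective φ) (hu : IsXCoord φ P u)
    (hv : IsXCoord φ P v) : u 0 * v 1 = v 0 * u 1 := by
  obtain ⟨c, hc, hu⟩ := hu
  obtain ⟨d, hd, hv⟩ := hv
  apply hφ
  simp only [map_mul, hu, hv]
  ring

lemma Point.IsXCoord.denom_ne_zero (hu : IsXCoord φ P u) (hv : IsXCoord φ P v) (hv1 : φ (v 1) ≠ 0) :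
    u 1 ≠ 0 := by
  obtain ⟨c, hc, hu⟩ := hu
  obtain ⟨d, hd, hv⟩ := hv
  intro h
  have hu1 := hu 1
  rw [h, _root_.map_zero, eq_comm, mul_eq_zero] at hu1
  exact hv1 (by rw [hv, hu1.resolve_left hc, mul_zero])

end Cross

variable {F : Type*} [Field F] [Fintype F] (W : WeierstrassCurve F)

lemma exists_isXCoord_frobPoint_add_sub [W.IsElliptic] [DecidableEq W.toAffine.FunctionField] :
    ∃ p m : F[X],
      algebraMap F[X] _ p = CoordinateRing.frobNum W (CoordinateRing.mk W.toAffine X) ∧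
      algebraMap F[X] _ m = CoordinateRing.frobNum W
        (CoordinateRing.negHom W (CoordinateRing.mk W.toAffine X)) ∧
      Point.IsXCoord (polyHom W) (frobPoint W + genericPoint W)
        ![p, (X ^ Fintype.card F - X) ^ 2] ∧
      Point.IsXCoord (polyHom W) (frobPoint W - genericPoint W)
        ![m, (X ^ Fintype.card F - X) ^ 2] := by
  have h := CoordinateRing.negHom_mk_X W
  obtain ⟨p, hp⟩ := CoordinateRing.exists_algebraMap_eq_frobNum h
  obtain ⟨m, hm⟩ := CoordinateRing.exists_algebraMap_eq_frobNum
    (η := CoordinateRing.negHom W (CoordinateRing.mk W.toAffine X)) <| by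
      rw [h, map_sub, map_neg, h, AlgHom.commutes]
  refine ⟨p, m, hp, hm, isXCoord_frobPoint_add hp _ rfl, ?_⟩
  rw [sub_eq_add_neg]
  refine isXCoord_frobPoint_add hm _ ?_
  simp only [h, negY, map_sub, map_neg, ← polyHom_apply, map_add, map_mul, map_a₁, map_a₃,
    RingHom.comp_apply]
  ring

variable {W}

/-- Values of the numerators of the `X`-coordinates of the sum and the difference of the Frobenius
point and the generic point. -/
lemma algebraMap_eval_frobNum {L : Type*} [Field L] [Algebra F L] {p m : F[X]}
    (hp : algebraMap F[X] _ p = CoordinateRing.frobNum W (CoordinateRing.mk W.toAffine X))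
    (hm : algebraMap F[X] _ m = CoordinateRing.frobNum W
        (CoordinateRing.negHom W (CoordinateRing.mk W.toAffine X))) (x : F) (y : L)
    (h : y ^ 2 + algebraMap F L (W.a₁ * x + W.a₃) * y =
      algebraMap F L (x ^ 3 + W.a₂ * x ^ 2 + W.a₄ * x + W.a₆)) :
    algebraMap F L (p.eval x) = (y ^ Fintype.card F - y) ^ 2 ∧
      algebraMap F L (m.eval x) =
        (y ^ Fintype.card F + y + algebraMap F L (W.a₁ * x + W.a₃)) ^ 2 := by
  obtain ⟨ψ, hψX, hψ⟩ := CoordinateRing.exists_specialization W x y h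
  rw [← hψ, ← hψ, hp, hm, CoordinateRing.negHom_mk_X]
  simp only [CoordinateRing.frobNum, map_sub, map_add, map_mul, map_neg, map_pow ψ, hψX]
  simp only [← map_mul, ← map_add, ← map_sub, hψ]
  simp [FiniteField.pow_card]
  ring

/-- The order at `x` of the denominator of the `X`-coordinate of the difference of the Frobenius
point and the generic point is the number of rational points with `X`-coordinate `x`. -/
lemma rootMultiplicity_eq_card {p m : F[X]}
    (hp : algebraMap F[X] _ p = CoordinateRing.frobNum W (CoordinateRing.mk W.toAffine X))
    (hm : algebraMap F[X] _ m = CoordinateRing.frobNum W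
        (CoordinateRing.negHom W (CoordinateRing.mk W.toAffine X)))
    {r s : Fin 2 → F[X]} (hr : IsPrimitiveVec r) (hs : IsPrimitiveVec s) (hr1 : r 1 ≠ 0)
    (hs1 : s 1 ≠ 0) (hrp : r 0 * (X ^ Fintype.card F - X) ^ 2 = p * r 1)
    (hsm : s 0 * (X ^ Fintype.card F - X) ^ 2 = m * s 1) (x : F)
    (hrs : (r 1).rootMultiplicity x + (s 1).rootMultiplicity x = 2) :
    (s 1).rootMultiplicity x = {y | W.toAffine.Equation x y}.ncard := by
  let L := AlgebraicClosure F
  have hg := FiniteField.X_pow_card_sub_X_ne_zero F (Fintype.one_lt_card (α := F))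
  have hgx := FiniteField.rootMultiplicity_X_pow_card_sub_X F x
  obtain ⟨hr2, hr3⟩ := hr.rootMultiplicity_of_cross hg hgx hr1 hrp
  obtain ⟨hs2, hs3⟩ := hs.rootMultiplicity_of_cross hg hgx hs1 hsm
  obtain ⟨y, hy⟩ : ∃ y : L, y ^ 2 + algebraMap F L (W.a₁ * x + W.a₃) * y =
      algebraMap F L (x ^ 3 + W.a₂ * x ^ 2 + W.a₄ * x + W.a₆) := by
    obtain ⟨y, hy⟩ := IsAlgClosed.exists_root (X ^ 2 + C (algebraMap F L (W.a₁ * x + W.a₃)) * X -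
      C (algebraMap F L (x ^ 3 + W.a₂ * x ^ 2 + W.a₄ * x + W.a₆))) (by
        rw [show degree _ = 2 by compute_degree!]
        decide)
    exact ⟨y, by simpa [sub_eq_zero] using hy⟩
  obtain ⟨hpx, hmx⟩ := algebraMap_eval_frobNum hp hm x y hy
  have hsol (z : F) : W.toAffine.Equation x z ↔
      algebraMap F L z = y ∨ algebraMap F L z = - y - algebraMap F L (W.a₁ * x + W.a₃) := by
    rw [equation_iff, ← (algebraMap F L).injective.eq_iff, ← sub_eq_zero (b := y),
      ← sub_eq_zero (b := - y - _), ← mul_eq_zero, ← sub_eq_zero]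
    simp only [map_add, map_mul, map_pow] at hy ⊢
    rw [← sub_eq_zero] at hy
    constructor
    · intro h
      linear_combination h - hy
    · intro h
      linear_combination h + hy
  by_cases hyq : y ^ Fintype.card F = y
  · obtain ⟨z, rfl⟩ := FiniteField.mem_range_algebraMap_of_pow_card_eq_self hyq
    have hneg : algebraMap F L (W.toAffine.negY x z) =
        - algebraMap F L z - algebraMap F L (W.a₁ * x + W.a₃) := by
      rw [← map_neg, ← map_sub, negY, sub_sub]
    have hset : {y | W.toAffine.Equation x y} = {z, W.toAffine.negY x z} := by
      ext t
      rw [Set.mem_ofPred_eq, Set.mem_insert_iff, Set.mem_singleton_iff, hsol, ← hneg,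
        (algebraMap F L).injective.eq_iff, (algebraMap F L).injective.eq_iff]
    have hp0 : p.eval x = 0 := by
      rw [← map_eq_zero_iff _ (algebraMap F L).injective, hpx, hyq, sub_self, sq, mul_zero]
    have hm0 : m.eval x = 0 ↔ z = W.toAffine.negY x z := by
      rw [← map_eq_zero_iff _ (algebraMap F L).injective, hmx, hyq, sq_eq_zero_iff,
        ← (algebraMap F L).injective.eq_iff, hneg, eq_sub_iff_add_eq, add_assoc,
        add_eq_zero_iff_neg_eq, eq_comm]
    have := hr3 hp0
    by_cases hz : z = W.toAffine.negY x z
    · rw [hset, ← hz, Set.pair_eq_singleton, Set.ncard_singleton]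
      have := hs3 (hm0.mpr hz)
      omega
    · rw [hset, Set.ncard_pair hz]
      have := hs2 (hm0.not.mpr hz)
      omega
  · have hset : {y | W.toAffine.Equation x y} = ∅ := by
      refine Set.eq_empty_of_forall_notMem fun z hz ↦ hyq ?_
      obtain ⟨t, rfl⟩ : ∃ t, algebraMap F L t = y := by
        obtain h | h := (hsol z).mp hz
        · exact ⟨z, h⟩
        · exact ⟨W.toAffine.negY x z, by simp only [negY, map_sub, map_neg, h, map_add]; ring⟩
      rw [← map_pow, FiniteField.pow_card]
    rw [hset, Set.ncard_empty]
    have := hr2 fun h ↦ hyq <| by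
      rwa [h, _root_.map_zero, eq_comm, sq_eq_zero_iff, sub_eq_zero] at hpx
    omega

end WeierstrassCurve.Affine

namespace WeierstrassCurve.Affine

namespace Point

variable {F K : Type*} [Field F] [Field K] {φ : F[X] →+* K}

lemma hasHeight_of_isXCoord_monic {V : WeierstrassCurve K} {P : V.toAffine.Point} {p : F[X]}
    (hp : p.Monic) (h : IsXCoord φ P ![p, 1]) : HasHeight φ P p.natDegree :=
  ⟨_, h, fun _ hq ↦ ⟨1, fun hq1 ↦ hq.not_isUnit (isUnit_of_dvd_one hq1)⟩,
    Fin.forall_fin_two.mpr ⟨le_rfl, by simp⟩, 0, by simp [hp.coeff_natDegree]⟩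

lemma IsXCoord.neg {V : WeierstrassCurve K} {P : V.toAffine.Point} {u : Fin 2 → F[X]}
    (h : IsXCoord φ P u) : IsXCoord φ (-P) u := by
  simpa only [IsXCoord, xRep_neg] using h

variable [DecidableEq K] {W : WeierstrassCurve F} [W.IsElliptic]
  {P Q : (W.map (φ.comp C)).toAffine.Point}

lemma exists_isXCoord_add_zsmul (hP : ∃ u, IsXCoord φ P u) (hQ : ∃ u, IsXCoord φ Q u)
    (hPQ : ∃ u, IsXCoord φ (P + Q) u) (n : ℤ) : ∃ u, IsXCoord φ (P + n • Q) u := by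
  obtain ⟨v, hQ⟩ := hQ
  suffices h : (∃ u, IsXCoord φ (P + n • Q) u) ∧ ∃ u, IsXCoord φ (P + (n + 1) • Q) u from h.1
  induction n with
  | zero => simpa using ⟨hP, hPQ⟩
  | succ n ih =>
    obtain ⟨⟨s, hs⟩, u, hu⟩ := ih
    refine ⟨⟨u, hu⟩, ?_⟩
    have := hu.exists_add (s := s) hQ (by convert hs using 1; rw [add_zsmul, one_zsmul]; abel)
    convert this using 3
    rw [add_zsmul _ (_ + 1), one_zsmul, add_assoc]
  | pred n ih =>
    obtain ⟨⟨u, hu⟩, s, hs⟩ := ih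
    refine ⟨?_, u, by rwa [sub_add_cancel]⟩
    have := hu.exists_add (s := s) hQ.neg
      (by convert hs using 1; rw [add_zsmul, one_zsmul]; abel)
    convert this using 3
    rw [sub_zsmul, one_zsmul, add_assoc]

/-- Heights grow quadratically along arithmetic progressions. -/
lemma exists_hasHeight_add_zsmul (hφ : Function.Injective φ) (hP : ∃ u, IsXCoord φ P u)
    (hQ : HasHeight φ Q 1) (hPQ : ∃ u, IsXCoord φ (P + Q) u) :
    ∃ d : ℤ → ℕ, (∀ n, HasHeight φ (P + n • Q) (d n)) ∧
      ∀ n, (d (n + 1) + d (n - 1) : ℤ) = 2 * d n + 2 := by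
  choose u hu using exists_isXCoord_add_zsmul hP (hQ.imp fun _ h ↦ h.1) hPQ
  choose d hd using fun n ↦ (hu n).exists_hasHeight
  refine ⟨d, hd, fun n ↦ ?_⟩
  have := (hd n).parallelogram (m := d (n + 1)) (n := d (n - 1)) hφ hQ
    (by convert hd (n + 1) using 1; rw [add_zsmul, one_zsmul, add_assoc])
    (by convert hd (n - 1) using 1; rw [sub_zsmul, one_zsmul, sub_eq_add_neg, add_assoc])
  exact_mod_cast this

end Point

variable {F : Type*} [Field F] (W : WeierstrassCurve F) [W.IsElliptic]

lemma hasHeight_genericPoint : Point.HasHeight (polyHom W) (genericPoint W) 1 :=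
  natDegree_X (R := F) ▸ Point.hasHeight_of_isXCoord_monic monic_X (isXCoord_genericPoint W)

variable [Fintype F]

lemma natCard_point_eq_sum :
    Nat.card W.toAffine.Point = ∑ x, {y | W.toAffine.Equation x y}.ncard + 1 := by
  rw [Nat.card_congr ((pointEquiv W.toAffine).trans
    (Equiv.subtypeProdEquivSigmaSubtype W.toAffine.Equation).optionCongr), Finite.card_option,
    Nat.card_sigma]
  rfl

lemma hasHeight_frobPoint : Point.HasHeight (polyHom W) (frobPoint W) (Fintype.card F) := by
  simpa using Point.hasHeight_of_isXCoord_monic (monic_X_pow _) (isXCoord_frobPoint W)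

variable [DecidableEq W.toAffine.FunctionField]

/-- The height of the difference of the Frobenius point and the generic point is the number of
rational points. -/
theorem hasHeight_frobPoint_sub_genericPoint :
    Point.HasHeight (polyHom W) (frobPoint W - genericPoint W) (Nat.card W.toAffine.Point) ∧
      Nat.card W.toAffine.Point ≤ 2 * Fintype.card F + 1 := by
  have hφ := polyHom_injective W
  have hg : polyHom W ((X ^ Fintype.card F - X) ^ 2) ≠ 0 :=
    (map_ne_zero_iff _ hφ).mpr <| pow_ne_zero 2 <|
      FiniteField.X_pow_card_sub_X_ne_zero F Fintype.one_lt_card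
  obtain ⟨p, m, hp, hm, hpx, hmx⟩ := exists_isXCoord_frobPoint_add_sub W
  obtain ⟨r, hr, hrp⟩ := hpx.exists_isPrimitiveVec
  obtain ⟨s, hs, hsp⟩ := hmx.exists_isPrimitiveVec
  obtain ⟨k, hk⟩ := exists_hasMaxDegree hrp.ne_zero
  obtain ⟨l, hl⟩ := exists_hasMaxDegree hsp.ne_zero
  have hr1 := hr.denom_ne_zero hpx hg
  have hs1 := hs.denom_ne_zero hmx hg
  have hrp' := hr.cross_mul_eq hφ hpx
  have hsm' := hs.cross_mul_eq hφ hmx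
  simp only [Matrix.cons_val] at hrp' hsm'
  have hkl := (hasHeight_frobPoint W).parallelogram hφ (hasHeight_genericPoint W)
    ⟨r, hr, hrp, hk⟩ ⟨s, hs, hsp, hl⟩
  have hone (p : F[X]) : IsPrimitiveVec ![p, 1] :=
    fun _ hq ↦ ⟨1, fun hq1 ↦ hq.not_isUnit (isUnit_of_dvd_one hq1)⟩
  obtain ⟨w, hw⟩ := (isXCoord_frobPoint W).exists_unit_addSubVec hφ (isXCoord_genericPoint W)
    hr hs (hone _) (hone _) hrp hsp
  have hw1 := hw 1
  have hw2 := hw 2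
  simp only [addSubVec, eval_addSubMap_one, eval_addSubMap_two, symProd, Matrix.cons_val,
    map_b₂, map_b₄, map_b₆, mul_one, one_mul] at hw1 hw2
  obtain ⟨hdeg, hmul, hsum⟩ := FiniteField.natDegree_eq_sum_rootMultiplicity (F := F) (w := w)
    (r := r 1) (s := s 1) (by rw [← hw2]; ring)
  have hcard : Nat.card W.toAffine.Point = (s 1).natDegree + 1 := by
    rw [natCard_point_eq_sum, hsum]
    congr 1
    refine Finset.sum_congr rfl fun x _ ↦ Eq.symm ?_
    exact rootMultiplicity_eq_card hp hm hrp hsp hr1 hs1 hrp' hsm' x (hmul x)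
  have h1 : (r 0 * s 1 + r 1 * s 0).natDegree ≤ 2 * Fintype.card F + 1 := by
    have hq : 1 ≤ Fintype.card F := Fintype.card_pos
    rw [← natDegree_eq_of_degree_eq (degree_eq_degree_of_associated
      (associated_unit_mul_left _ _ w.isUnit)), ← hw1]
    compute_degree
    all_goals omega
  have hl' := hk.eq_natDegree_add_one hl hr1 hs1 hdeg (by omega) h1
  refine ⟨?_, by omega⟩
  rw [hcard, ← hl']
  exact ⟨s, hs, hsp, hl⟩

end WeierstrassCurve.Affine

/-- Hasse's inequality: for an elliptic curve `E` over a finite field `F` with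
`q` elements, `|q + 1 - #E(F)| ≤ 2 √q`. -/
theorem hasse_inequality (F : Type*) [Field F] [Fintype F]
    (E : WeierstrassCurve F) [E.IsElliptic] :
    |(Fintype.card F : ℝ) + 1 - (Nat.card E.toAffine.Point : ℝ)| ≤
      2 * Real.sqrt (Fintype.card F) := by
  classical
  open WeierstrassCurve.Affine in
  have hφ := polyHom_injective E
  have hfrob := hasHeight_frobPoint E
  obtain ⟨hsub, hle⟩ := hasHeight_frobPoint_sub_genericPoint E
  obtain ⟨p, -, -, -, hp, -⟩ := exists_isXCoord_frobPoint_add_sub E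
  obtain ⟨d, hd, hrec⟩ := Point.exists_hasHeight_add_zsmul hφ ⟨_, isXCoord_frobPoint E⟩
    (hasHeight_genericPoint E) ⟨_, hp⟩
  have h0 : d 0 = Fintype.card F := (hd 0).unique hφ (by simpa using hfrob)
  have h1 : d (-1) = Nat.card E.toAffine.Point :=
    (hd (-1)).unique hφ (by simpa [← sub_eq_add_neg] using hsub)
  have hpos : 0 < Nat.card E.toAffine.Point := by
    rw [natCard_point_eq_sum]
    exact Nat.succ_pos _
  have hquad := Int.eq_quadratic_of_second_difference (d := fun n ↦ d n) hrec
  set a : ℤ := d 1 - d 0 - 1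
  have ha : a = Fintype.card F + 1 - Nat.card E.toAffine.Point := by
    have := hquad (-1)
    simp only [h0, h1] at this
    linarith
  have hsq : a ^ 2 ≤ 4 * (Fintype.card F : ℤ) := by
    refine Int.sq_le_of_forall_quadratic_nonneg (FiniteField.isPrimePow_card F) ?_ fun n ↦ ?_
    · rw [ha, abs_le]
      omega
    · rw [← h0, ← hquad]
      positivity
  have hcast : (a : ℝ) = Fintype.card F + 1 - Nat.card E.toAffine.Point := by
    exact_mod_cast ha
  rw [← hcast]
  refine abs_le_of_sq_le_sq ?_ (by positivity)
  rw [mul_pow, Real.sq_sqrt (by positivity)]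
  norm_num
  exact_mod_cast hsq
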